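/- arXiv:2010.10047 — 6 statements merged into one kernel-verified Lean document; each statement's English description precedes it below -/
import Mathlib

section
/- Let E be a normed real vector space, L : E → E any map, and Δt_CFL > 0 such that the forward Euler step is strongly stable up to Δt_CFL. Let m ≥ 1 and let α, β : ℕ → ℕ → ℝ be coefficient arrays with α i k ≥ 0 and β i k ≥ 0 for all 0 ≤ k < i ≤ m, and ∑_{k=0}^{i-1} α i k = 1 for each 1 ≤ i ≤ m. Let Δt ≥ 0 satisfy Δt · β i k ≤ α i k · Δt_CFL for all 0 ≤ k < i ≤ m. If the stage values u : ℕ → E satisfy u i = ∑_{k=0}^{i-1} ( α i k • u k + (Δt · β i k) • L (u k) ) for every 1 ≤ i ≤ m, then ‖u i‖ ≤ ‖u 0‖ for every 0 ≤ i ≤ m; in particular ‖u m‖ ≤ ‖u 0‖. -/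
/-- A scaled forward Euler step `a • v + b • L v` with `0 ≤ b ≤ a * T` has norm at most `a * ‖v‖`
when forward Euler is strongly stable up to `T`. -/
theorem norm_smul_add_smul_le_of_forwardEuler
    {E : Type*} [SeminormedAddCommGroup E] [NormedSpace ℝ E] {L : E → E} {T : ℝ}
    (hEuler : ∀ (v : E) (t : ℝ), 0 ≤ t → t ≤ T → ‖v + t • L v‖ ≤ ‖v‖)
    {a b : ℝ} (ha : 0 ≤ a) (hb : 0 ≤ b) (hab : b ≤ a * T) (v : E) :
    ‖a • v + b • L v‖ ≤ a * ‖v‖ := by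
  rcases ha.eq_or_lt with rfl | ha'
  · obtain rfl : b = 0 := le_antisymm (by simpa using hab) hb
    simp
  · have hfactor : a • v + b • L v = a • (v + (b / a) • L v) := by
      rw [smul_add, smul_smul, mul_div_cancel₀ b ha'.ne']
    rw [hfactor, norm_smul, Real.norm_of_nonneg ha]
    exact mul_le_mul_of_nonneg_left
      (hEuler v (b / a) (div_nonneg hb ha) ((div_le_iff₀' ha').2 hab)) ha

/-- General Shu–Osher form Runge–Kutta method with nonnegative coefficients and
convex-combination consistency is strongly stable under the CFL-type restriction
`Δt · β i k ≤ α i k · Δt_CFL`, provided forward Euler is strongly stable up to `Δt_CFL`. -/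
theorem ssp_runge_kutta_strong_stability
    {E : Type*} [NormedAddCommGroup E] [NormedSpace ℝ E]
    (L : E → E) (ΔtCFL : ℝ) (hCFL : 0 < ΔtCFL)
    (hEuler : ∀ (v : E) (t : ℝ), 0 ≤ t → t ≤ ΔtCFL → ‖v + t • L v‖ ≤ ‖v‖)
    (m : ℕ) (hm : 1 ≤ m) (α β : ℕ → ℕ → ℝ)
    (hα : ∀ i k, k < i → i ≤ m → 0 ≤ α i k)
    (hβ : ∀ i k, k < i → i ≤ m → 0 ≤ β i k)
    (hsum : ∀ i, 1 ≤ i → i ≤ m → ∑ k ∈ Finset.range i, α i k = 1)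
    (Δt : ℝ) (hΔt : 0 ≤ Δt)
    (hcfl : ∀ i k, k < i → i ≤ m → Δt * β i k ≤ α i k * ΔtCFL)
    (u : ℕ → E)
    (hu : ∀ i, 1 ≤ i → i ≤ m →
      u i = ∑ k ∈ Finset.range i, (α i k • u k + (Δt * β i k) • L (u k))) :
    (∀ i, i ≤ m → ‖u i‖ ≤ ‖u 0‖) ∧ ‖u m‖ ≤ ‖u 0‖ := by
  have hstage : ∀ i, i ≤ m → ‖u i‖ ≤ ‖u 0‖ := by
    intro i
    induction i using Nat.strong_induction_on with
    | _ i ih =>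
      intro him
      rcases Nat.eq_zero_or_pos i with rfl | hi
      · exact le_rfl
      calc ‖u i‖ = ‖∑ k ∈ Finset.range i, (α i k • u k + (Δt * β i k) • L (u k))‖ := by
            rw [← hu i hi him]
        _ ≤ ∑ k ∈ Finset.range i, α i k * ‖u 0‖ := by
            refine norm_sum_le_of_le _ fun k hk => ?_
            have hki : k < i := Finset.mem_range.1 hk
            exact (norm_smul_add_smul_le_of_forwardEuler hEuler (hα i k hki him)
              (mul_nonneg hΔt (hβ i k hki him)) (hcfl i k hki him) (u k)).trans
              (mul_le_mul_of_nonneg_left (ih k hki (hki.le.trans him)) (hα i k hki him))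
        _ = ‖u 0‖ := by rw [← Finset.sum_mul, hsum i hi him, one_mul]
  exact ⟨hstage, hstage m le_rfl⟩
end

section
/- Let E be a normed real vector space, L : E → E any map, and Δt_CFL > 0 such that the forward Euler step is strongly stable up to Δt_CFL. Let 0 ≤ Δt ≤ Δt_CFL and let u ∈ E. Define u¹ = u + Δt • L u and u⁺ = (1/2) • u + (1/2) • u¹ + (Δt/2) • L u¹ (the second-order SSP Runge–Kutta update). Then ‖u⁺‖ ≤ ‖u‖. That is, the optimal second-order SSP Runge–Kutta method is strongly stable with CFL coefficient c = 1. -/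
/-- The optimal second-order SSP Runge–Kutta method is strongly stable with CFL
coefficient `c = 1`: if forward Euler is strongly stable up to `Δt_CFL` and
`0 ≤ Δt ≤ Δt_CFL`, then the SSP2 update does not increase the norm. -/
theorem ssp2_strong_stability
    {E : Type*} [NormedAddCommGroup E] [NormedSpace ℝ E]
    (L : E → E) (ΔtCFL : ℝ) (hCFL : 0 < ΔtCFL)
    (hEuler : ∀ (v : E) (t : ℝ), 0 ≤ t → t ≤ ΔtCFL → ‖v + t • L v‖ ≤ ‖v‖)
    (Δt : ℝ) (hΔt : 0 ≤ Δt) (hΔt' : Δt ≤ ΔtCFL)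
    (u u1 uplus : E)
    (hu1 : u1 = u + Δt • L u)
    (huplus : uplus = (1/2 : ℝ) • u + (1/2 : ℝ) • u1 + (Δt/2) • L u1) :
    ‖uplus‖ ≤ ‖u‖ := by
  have h1 : ‖u1‖ ≤ ‖u‖ := hu1 ▸ hEuler u Δt hΔt hΔt'
  have h2 : ‖u1 + Δt • L u1‖ ≤ ‖u‖ := (hEuler u1 Δt hΔt hΔt').trans h1
  have h : uplus = (1/2 : ℝ) • u + (1/2 : ℝ) • (u1 + Δt • L u1) := by
    rw [huplus]
    module
  have hball := convex_closedBall (0 : E) ‖u‖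
    (mem_closedBall_zero_iff.2 le_rfl) (mem_closedBall_zero_iff.2 h2)
    (by norm_num : (0 : ℝ) ≤ 1/2) (by norm_num : (0 : ℝ) ≤ 1/2) (by norm_num)
  rwa [← h, mem_closedBall_zero_iff] at hball
end

section
/- Let E be a normed real vector space, L : E → E any map, and Δt_CFL > 0 such that the forward Euler step is strongly stable up to Δt_CFL. Let 0 ≤ Δt ≤ Δt_CFL and let u ∈ E. Define u¹ = u + Δt • L u, u² = (3/4) • u + (1/4) • u¹ + (Δt/4) • L u¹, and u⁺ = (1/3) • u + (2/3) • u² + (2Δt/3) • L u² (the third-order SSP Runge–Kutta update). Then ‖u⁺‖ ≤ ‖u‖. That is, the optimal third-order SSP Runge–Kutta method is strongly stable with CFL coefficient c = 1. -/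
/-- The optimal third-order SSP Runge–Kutta method is strongly stable with CFL
coefficient `c = 1`: if forward Euler is strongly stable up to `Δt_CFL` and
`0 ≤ Δt ≤ Δt_CFL`, then the SSP3 update does not increase the norm. -/
theorem ssp3_strong_stability
    {E : Type*} [NormedAddCommGroup E] [NormedSpace ℝ E]
    (L : E → E) (ΔtCFL : ℝ) (hCFL : 0 < ΔtCFL)
    (hEuler : ∀ (v : E) (t : ℝ), 0 ≤ t → t ≤ ΔtCFL → ‖v + t • L v‖ ≤ ‖v‖)
    (Δt : ℝ) (hΔt : 0 ≤ Δt) (hΔt' : Δt ≤ ΔtCFL)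
    (u u1 u2 uplus : E)
    (hu1 : u1 = u + Δt • L u)
    (hu2 : u2 = (3/4 : ℝ) • u + (1/4 : ℝ) • u1 + (Δt/4) • L u1)
    (huplus : uplus = (1/3 : ℝ) • u + (2/3 : ℝ) • u2 + (2*Δt/3) • L u2) :
    ‖uplus‖ ≤ ‖u‖ := by
  have euler_le {v : E} (hv : ‖v‖ ≤ ‖u‖) : ‖v + Δt • L v‖ ≤ ‖u‖ :=
    (hEuler v Δt hΔt hΔt').trans hv
  have combo_le {a b : ℝ} (ha : 0 ≤ a) (hb : 0 ≤ b) (hab : a + b = 1) {w : E}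
      (hw : ‖w‖ ≤ ‖u‖) : ‖a • u + b • w‖ ≤ ‖u‖ := by
    simpa using convex_closedBall (0 : E) ‖u‖ (by simp) (by simpa using hw) ha hb hab
  have h1 : ‖u1‖ ≤ ‖u‖ := hu1 ▸ euler_le le_rfl
  have h2 : ‖u2‖ ≤ ‖u‖ := by
    have h : u2 = (3/4 : ℝ) • u + (1/4 : ℝ) • (u1 + Δt • L u1) := by rw [hu2]; module
    exact h ▸ combo_le (by norm_num) (by norm_num) (by norm_num) (euler_le h1)
  have h : uplus = (1/3 : ℝ) • u + (2/3 : ℝ) • (u2 + Δt • L u2) := by rw [huplus]; module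
  exact h ▸ combo_le (by norm_num) (by norm_num) (by norm_num) (euler_le h2)
end

section
/- No two-stage second-order SSP Runge–Kutta scheme has CFL coefficient greater than 1. Concretely: let β₁₀ > 0, α₂₁ ≥ 0 and c > 1 be real numbers such that 1 ≥ c · β₁₀ (the CFL constraint α₁₀ ≥ c β₁₀ with α₁₀ = 1) and α₂₁ ≥ c · (1/(2β₁₀)) (the CFL constraint α₂₁ ≥ c β₂₁ with β₂₁ = 1/(2β₁₀)). Then β₂₀ := 1 − 1/(2β₁₀) − α₂₁·β₁₀ < 0, so the coefficient β₂₀ fails to be nonnegative and the scheme cannot be SSP with CFL coefficient c. -/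
/-- No two-stage second-order SSP Runge–Kutta scheme has CFL coefficient greater
than 1: under the CFL constraints `1 ≥ c·β₁₀` and `α₂₁ ≥ c·(1/(2β₁₀))` with `c > 1`,
the derived coefficient `β₂₀ = 1 − 1/(2β₁₀) − α₂₁·β₁₀` is negative. -/
theorem no_ssp2_cfl_greater_than_one
    (β₁₀ α₂₁ c : ℝ) (hβ : 0 < β₁₀) (hα : 0 ≤ α₂₁) (hc : 1 < c)
    (h1 : c * β₁₀ ≤ 1) (h2 : c * (1 / (2 * β₁₀)) ≤ α₂₁) :
    1 - 1 / (2 * β₁₀) - α₂₁ * β₁₀ < 0 := by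
  have hx : c / 2 ≤ 1 / (2 * β₁₀) := by
    rw [le_div_iff₀ (by positivity)]
    linarith
  have hy : c / 2 ≤ α₂₁ * β₁₀ := by
    calc c / 2 = c * (1 / (2 * β₁₀)) * β₁₀ := by field_simp
      _ ≤ α₂₁ * β₁₀ := by gcongr
  linarith
end

section
/- Let n ≥ 1, let L be a map on grid functions u : Fin (n+1) → ℝ, and let Δt > 0 be such that the forward Euler step with step Δt is TVD. Then the second-order SSP Runge–Kutta update is TVD: for every grid function u, setting u¹ = u + Δt • L u and u⁺ = (1/2) • u + (1/2) • u¹ + (Δt/2) • L u¹, we have TV(u⁺) ≤ TV(u). -/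
/-- Total variation seminorm of a grid function `u : Fin (n+1) → ℝ`:
`TV(u) = Σ_{j=0}^{n-1} |u(j+1) − u(j)|`. -/
noncomputable def totalVariation {n : ℕ} (u : Fin (n + 1) → ℝ) : ℝ :=
  ∑ j : Fin n, |u j.succ - u j.castSucc|

theorem totalVariation_add_le {n : ℕ} (u v : Fin (n + 1) → ℝ) :
    totalVariation (u + v) ≤ totalVariation u + totalVariation v := by
  simp only [totalVariation, ← Finset.sum_add_distrib, Pi.add_apply, add_sub_add_comm]
  exact Finset.sum_le_sum fun j _ => abs_add_le _ _

theorem totalVariation_smul {n : ℕ} (c : ℝ) (u : Fin (n + 1) → ℝ) :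
    totalVariation (c • u) = |c| * totalVariation u := by
  simp only [totalVariation, Finset.mul_sum, Pi.smul_apply, smul_eq_mul, ← mul_sub, abs_mul]

/-- If the forward Euler step with step `Δt` is TVD, then the second-order SSP
Runge–Kutta update is TVD. -/
theorem ssp2_tvd
    (n : ℕ) (hn : 1 ≤ n)
    (L : (Fin (n + 1) → ℝ) → (Fin (n + 1) → ℝ))
    (Δt : ℝ) (hΔt : 0 < Δt)
    (hEuler : ∀ v : Fin (n + 1) → ℝ,
      totalVariation (v + Δt • L v) ≤ totalVariation v)
    (u u1 uplus : Fin (n + 1) → ℝ)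
    (hu1 : u1 = u + Δt • L u)
    (huplus : uplus = (1/2 : ℝ) • u + (1/2 : ℝ) • u1 + (Δt/2) • L u1) :
    totalVariation uplus ≤ totalVariation u := by
  have hconvex : uplus = (1/2 : ℝ) • u + (1/2 : ℝ) • (u1 + Δt • L u1) := by
    rw [huplus]
    module
  have hstep : totalVariation (u1 + Δt • L u1) ≤ totalVariation u :=
    (hEuler u1).trans (hu1 ▸ hEuler u)
  calc totalVariation uplus
      ≤ totalVariation ((1/2 : ℝ) • u) + totalVariation ((1/2 : ℝ) • (u1 + Δt • L u1)) :=
        hconvex ▸ totalVariation_add_le _ _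
    _ = 1/2 * totalVariation u + 1/2 * totalVariation (u1 + Δt • L u1) := by
        rw [totalVariation_smul, totalVariation_smul, abs_of_pos one_half_pos]
    _ ≤ totalVariation u := by linarith
end

section
/- Let n ≥ 1, let L be a map on grid functions u : Fin (n+1) → ℝ, and let Δt > 0 be such that the forward Euler step with step Δt is TVD. Then the third-order SSP Runge–Kutta update is TVD: for every grid function u, setting u¹ = u + Δt • L u, u² = (3/4) • u + (1/4) • u¹ + (Δt/4) • L u¹, and u⁺ = (1/3) • u + (2/3) • u² + (2Δt/3) • L u², we have TV(u⁺) ≤ TV(u). -/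
theorem totalVariation_smul_add_smul_le {n : ℕ} {a b : ℝ} (ha : 0 ≤ a) (hb : 0 ≤ b)
    (v w : Fin (n + 1) → ℝ) :
    totalVariation (a • v + b • w) ≤ a * totalVariation v + b * totalVariation w := by
  unfold totalVariation
  rw [Finset.mul_sum, Finset.mul_sum, ← Finset.sum_add_distrib]
  refine Finset.sum_le_sum fun j _ => ?_
  simp only [Pi.add_apply, Pi.smul_apply, smul_eq_mul]
  calc |a * v j.succ + b * w j.succ - (a * v j.castSucc + b * w j.castSucc)|
      = |a * (v j.succ - v j.castSucc) + b * (w j.succ - w j.castSucc)| := by ring_nf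
    _ ≤ |a * (v j.succ - v j.castSucc)| + |b * (w j.succ - w j.castSucc)| := abs_add_le _ _
    _ = a * |v j.succ - v j.castSucc| + b * |w j.succ - w j.castSucc| := by
      rw [abs_mul, abs_mul, abs_of_nonneg ha, abs_of_nonneg hb]

/-- If the forward Euler step with step `Δt` is TVD, then the third-order SSP
Runge–Kutta update is TVD. -/
theorem ssp3_tvd
    (n : ℕ) (hn : 1 ≤ n)
    (L : (Fin (n + 1) → ℝ) → (Fin (n + 1) → ℝ))
    (Δt : ℝ) (hΔt : 0 < Δt)
    (hEuler : ∀ v : Fin (n + 1) → ℝ,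
      totalVariation (v + Δt • L v) ≤ totalVariation v)
    (u u1 u2 uplus : Fin (n + 1) → ℝ)
    (hu1 : u1 = u + Δt • L u)
    (hu2 : u2 = (3/4 : ℝ) • u + (1/4 : ℝ) • u1 + (Δt/4) • L u1)
    (huplus : uplus = (1/3 : ℝ) • u + (2/3 : ℝ) • u2 + (2*Δt/3) • L u2) :
    totalVariation uplus ≤ totalVariation u := by
  have h1 : totalVariation u1 ≤ totalVariation u := hu1 ▸ hEuler u
  have e2 : u2 = (3/4 : ℝ) • u + (1/4 : ℝ) • (u1 + Δt • L u1) := by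
    rw [hu2]; module
  have e3 : uplus = (1/3 : ℝ) • u + (2/3 : ℝ) • (u2 + Δt • L u2) := by
    rw [huplus]; module
  have h2 := totalVariation_smul_add_smul_le (a := 3/4) (b := 1/4) (by norm_num) (by norm_num)
    u (u1 + Δt • L u1)
  have h3 := totalVariation_smul_add_smul_le (a := 1/3) (b := 2/3) (by norm_num) (by norm_num)
    u (u2 + Δt • L u2)
  rw [← e2] at h2
  rw [← e3] at h3
  linarith [hEuler u1, hEuler u2]
end
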